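/- Let G be a cubic graph with vertices v_0,…,v_{n−1} (n even) and edges e_0,…,e_{m−1}, m = 3n/2, and let J_G be the JRP-D instance associated with G. If J_G has a feasible schedule of cost at most 10.5·n + K + 6 for a nonnegative integer K, then G has a vertex cover of size at most K. -/

import Mathlib

/-- An order `(t, R)` satisfies the demand of retailer `ρ` with period `[r, d]`. -/
def SatJG (S : Finset (ℝ × Finset ℕ)) (ρ : ℕ) (r d : ℝ) : Prop :=
  ∃ o ∈ S, ρ ∈ o.2 ∧ r ≤ o.1 ∧ o.1 ≤ d

/-- The time point `α_{i,a}` associated with vertex `i` and its `a`-th incident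
edge `j i a`: it is `2·(j i a)` if `i` is smaller than the other endpoint,
and `2·(j i a) + 1` otherwise. -/
def alphaPt {n m : ℕ} (E : Fin m → Fin n × Fin n) (j : Fin n → Fin 3 → Fin m)
    (i : Fin n) (a : Fin 3) : ℝ :=
  let e := j i a
  let i' : Fin n := if (E e).1 = i then (E e).2 else (E e).1
  if (i : ℕ) < (i' : ℕ) then 2 * (e : ℕ) else 2 * (e : ℕ) + 1

/-- The time point `β_i = 8m − i` associated with vertex `i`. -/
def betaPt (m : ℕ) (i : ℕ) : ℝ := 8 * (m : ℝ) - (i : ℝ)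

/-- Feasibility of a schedule for the instance `J_G`: every demand of the
support retailer 0, of the edge retailers `1,…,m`, and of the vertex retailers
`ρ_{i,a} = m+1+3i+a` is satisfied. -/
def FeasibleJG {n m : ℕ} (E : Fin m → Fin n × Fin n) (j : Fin n → Fin 3 → Fin m)
    (S : Finset (ℝ × Finset ℕ)) : Prop :=
  (SatJG S 0 (-(4 * (m : ℝ)) - 1) (-1) ∧
   SatJG S 0 (2 * (m : ℝ)) (6 * (m : ℝ)) ∧
   SatJG S 0 (8 * (m : ℝ) + 1) (12 * (m : ℝ) + 1)) ∧
  (∀ e : Fin m,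
    SatJG S ((e : ℕ) + 1) (2 * (e : ℕ) + 1 - 4 * (m : ℝ)) (2 * (e : ℕ) + 1) ∧
    SatJG S ((e : ℕ) + 1) (2 * (e : ℕ)) (2 * (e : ℕ) + 4 * (m : ℝ))) ∧
  (∀ i : Fin n, ∀ a : Fin 3,
    SatJG S (m + 1 + 3 * (i : ℕ) + (a : ℕ)) (alphaPt E j i a - 4 * (m : ℝ)) (alphaPt E j i a) ∧
    SatJG S (m + 1 + 3 * (i : ℕ) + (a : ℕ)) (alphaPt E j i a) (alphaPt E j i a + 4 * (m : ℝ)) ∧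
    SatJG S (m + 1 + 3 * (i : ℕ) + (a : ℕ)) (betaPt m i - 4 * (m : ℝ)) (betaPt m i) ∧
    SatJG S (m + 1 + 3 * (i : ℕ) + (a : ℕ)) (betaPt m i) (betaPt m i + 4 * (m : ℝ)))

/-- The cost of a schedule in `J_G` (all ordering costs equal 1). -/
noncomputable def costJG (S : Finset (ℝ × Finset ℕ)) : ℝ :=
  ∑ o ∈ S, (1 + (o.2.card : ℝ))

open Finset in
/-- The number of orders of `S` in which retailer `ρ` participates. -/
def retailerOrders (S : Finset (ℝ × Finset ℕ)) (ρ : ℕ) : ℕ := #{o ∈ S | ρ ∈ o.2}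

open Classical in
/-- The indicator of the times at which `S` places an order. -/
noncomputable def orderAt (S : Finset (ℝ × Finset ℕ)) (t : ℝ) : ℕ :=
  if ∃ o ∈ S, o.1 = t then 1 else 0

open Finset in
/-- The number of orders of `S` placed at times in `[2e, 2e + 1]`. -/
noncomputable def slotOrders (S : Finset (ℝ × Finset ℕ)) (e : ℕ) : ℕ :=
  #{o ∈ S | 2 * (e : ℝ) ≤ o.1 ∧ o.1 ≤ 2 * (e : ℝ) + 1}

/-- The time point in the slot of edge `e` that belongs to its endpoint `i`. -/
def sidePt {n m : ℕ} (E : Fin m → Fin n × Fin n) (i : Fin n) (e : Fin m) : ℝ :=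
  let i' : Fin n := if (E e).1 = i then (E e).2 else (E e).1
  if (i : ℕ) < (i' : ℕ) then 2 * (e : ℕ) else 2 * (e : ℕ) + 1

lemma sidePt_mem {n m : ℕ} (E : Fin m → Fin n × Fin n) (i : Fin n) (e : Fin m) :
    2 * (e : ℝ) ≤ sidePt E i e ∧ sidePt E i e ≤ 2 * (e : ℝ) + 1 := by
  unfold sidePt
  dsimp only
  split_ifs <;> constructor <;> linarith

lemma sidePt_endpoints {n m : ℕ} {E : Fin m → Fin n × Fin n} {e : Fin m}
    (h : (E e).1 ≠ (E e).2) : sidePt E (E e).1 e ≠ sidePt E (E e).2 e := by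
  have h' : ((E e).1 : ℕ) ≠ ((E e).2 : ℕ) := fun hh => h (Fin.ext hh)
  unfold sidePt
  simp only [if_true, if_neg h]
  rcases lt_or_gt_of_ne h' with h1 | h1
  · simp [h1, h1.not_gt]
  · simp [h1, h1.not_gt]

lemma orderAt_le_one (S : Finset (ℝ × Finset ℕ)) (t : ℝ) : orderAt S t ≤ 1 := by
  unfold orderAt; split_ifs <;> simp

lemma orderAt_le_card (S : Finset (ℝ × Finset ℕ)) (t : ℝ) :
    orderAt S t ≤ (S.filter (fun o => o.1 = t)).card := by
  unfold orderAt
  split_ifs with h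
  · obtain ⟨o, ho, h⟩ := h
    exact Finset.card_pos.2 ⟨o, Finset.mem_filter.2 ⟨ho, h⟩⟩
  · simp

lemma ne_of_orderAt_eq_zero {S : Finset (ℝ × Finset ℕ)} {t : ℝ} (h : orderAt S t = 0)
    {o : ℝ × Finset ℕ} (ho : o ∈ S) : o.1 ≠ t := by
  intro hh
  unfold orderAt at h
  rw [if_pos ⟨o, ho, hh⟩] at h
  exact one_ne_zero h

lemma SatJG.one_le {S : Finset (ℝ × Finset ℕ)} {ρ : ℕ} {r d : ℝ} (h : SatJG S ρ r d) :
    1 ≤ retailerOrders S ρ := by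
  obtain ⟨o, ho, hρ, -⟩ := h
  exact Finset.card_pos.2 ⟨o, Finset.mem_filter.2 ⟨ho, hρ⟩⟩

lemma two_le_retailerOrders {S : Finset (ℝ × Finset ℕ)} {ρ : ℕ} {o₁ o₂ : ℝ × Finset ℕ}
    (h₁ : o₁ ∈ S) (h₂ : o₂ ∈ S) (hρ₁ : ρ ∈ o₁.2) (hρ₂ : ρ ∈ o₂.2) (h : o₁.1 < o₂.1) :
    2 ≤ retailerOrders S ρ :=
  Finset.one_lt_card.2 ⟨o₁, Finset.mem_filter.2 ⟨h₁, hρ₁⟩, o₂, Finset.mem_filter.2 ⟨h₂, hρ₂⟩,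
    fun hh => h.ne (congrArg Prod.fst hh)⟩

lemma three_le_retailerOrders {S : Finset (ℝ × Finset ℕ)} {ρ : ℕ} {o₁ o₂ o₃ : ℝ × Finset ℕ}
    (h₁ : o₁ ∈ S) (h₂ : o₂ ∈ S) (h₃ : o₃ ∈ S) (hρ₁ : ρ ∈ o₁.2) (hρ₂ : ρ ∈ o₂.2)
    (hρ₃ : ρ ∈ o₃.2) (h : o₁.1 < o₂.1) (h' : o₂.1 < o₃.1) : 3 ≤ retailerOrders S ρ :=
  Finset.two_lt_card.2 ⟨o₁, Finset.mem_filter.2 ⟨h₁, hρ₁⟩, o₂, Finset.mem_filter.2 ⟨h₂, hρ₂⟩,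
    o₃, Finset.mem_filter.2 ⟨h₃, hρ₃⟩, fun hh => h.ne (congrArg Prod.fst hh),
    fun hh => (h.trans h').ne (congrArg Prod.fst hh), fun hh => h'.ne (congrArg Prod.fst hh)⟩

/-- A retailer with demand periods of length `L` ending and starting at `α` and at `β`
needs three orders, unless orders are placed at both `α` and `β`. -/
lemma three_le_retailerOrders_add {S : Finset (ℝ × Finset ℕ)} {ρ : ℕ} {α β L : ℝ}
    (hαβ : α + L < β)
    (h₁ : SatJG S ρ (α - L) α) (h₂ : SatJG S ρ α (α + L))
    (h₃ : SatJG S ρ (β - L) β) (h₄ : SatJG S ρ β (β + L)) :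
    3 ≤ retailerOrders S ρ + orderAt S β * orderAt S α := by
  obtain ⟨o₁, m₁, r₁, l₁, u₁⟩ := h₁
  obtain ⟨o₂, m₂, r₂, l₂, u₂⟩ := h₂
  obtain ⟨o₃, m₃, r₃, l₃, u₃⟩ := h₃
  obtain ⟨o₄, m₄, r₄, l₄, u₄⟩ := h₄
  by_cases hα : orderAt S α = 0
  · have := lt_of_le_of_ne u₁ (ne_of_orderAt_eq_zero hα m₁)
    have := three_le_retailerOrders m₁ m₂ m₄ r₁ r₂ r₄ (by linarith) (by linarith)
    omega
  by_cases hβ : orderAt S β = 0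
  · have := lt_of_le_of_ne u₃ (ne_of_orderAt_eq_zero hβ m₃)
    have := three_le_retailerOrders m₁ m₃ m₄ r₁ r₃ r₄ (by linarith) (by linarith)
    omega
  have := two_le_retailerOrders m₁ m₄ r₁ r₄ (by linarith)
  have := Nat.mul_pos (Nat.pos_of_ne_zero hβ) (Nat.pos_of_ne_zero hα)
  omega

lemma orderAt_add_le_slotOrders (S : Finset (ℝ × Finset ℕ)) {e : ℕ} {s t : ℝ} (hst : s ≠ t)
    (hs : 2 * (e : ℝ) ≤ s ∧ s ≤ 2 * (e : ℝ) + 1) (ht : 2 * (e : ℝ) ≤ t ∧ t ≤ 2 * (e : ℝ) + 1) :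
    orderAt S s + orderAt S t ≤ slotOrders S e := by
  classical
  refine (add_le_add (orderAt_le_card S s) (orderAt_le_card S t)).trans ?_
  rw [← Finset.card_union_of_disjoint]
  · refine Finset.card_le_card fun o ho => ?_
    simp only [Finset.mem_union, Finset.mem_filter] at ho ⊢
    rcases ho with ⟨h, rfl⟩ | ⟨h, rfl⟩
    · exact ⟨h, hs⟩
    · exact ⟨h, ht⟩
  · rw [Finset.disjoint_filter]
    rintro o - rfl h
    exact hst h

lemma two_le_retailerOrders_of_slotOrders_eq_zero {S : Finset (ℝ × Finset ℕ)} {ρ e : ℕ} {L : ℝ}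
    (h₁ : SatJG S ρ (2 * (e : ℝ) + 1 - L) (2 * (e : ℝ) + 1))
    (h₂ : SatJG S ρ (2 * (e : ℝ)) (2 * (e : ℝ) + L)) (h : slotOrders S e = 0) :
    2 ≤ retailerOrders S ρ := by
  obtain ⟨o₁, m₁, r₁, l₁, u₁⟩ := h₁
  obtain ⟨o₂, m₂, r₂, l₂, u₂⟩ := h₂
  have hs : ∀ o ∈ S, ¬ (2 * (e : ℝ) ≤ o.1 ∧ o.1 ≤ 2 * (e : ℝ) + 1) :=
    Finset.filter_eq_empty_iff.1 (Finset.card_eq_zero.1 h)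
  have h₁ : o₁.1 < 2 * (e : ℝ) := not_le.1 fun hh => hs o₁ m₁ ⟨hh, u₁⟩
  exact two_le_retailerOrders m₁ m₂ r₁ r₂ (h₁.trans_le l₂)

lemma sum_range_three_mul (g : ℕ → ℕ) (n : ℕ) :
    ∑ k ∈ Finset.range (3 * n), g k = ∑ i : Fin n, ∑ a : Fin 3, g (3 * i + a) := by
  rw [Fin.sum_univ_eq_sum_range (fun i => ∑ a : Fin 3, g (3 * i + a))]
  induction n with
  | zero => simp
  | succ n ih =>
    rw [Finset.sum_range_succ, ← ih, Nat.mul_succ, Finset.sum_range_add]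
    simp [Fin.sum_univ_three, Finset.sum_range_succ]

lemma sum_retailerOrders_le (S : Finset (ℝ × Finset ℕ)) (n m : ℕ) :
    retailerOrders S 0 + ∑ e : Fin m, retailerOrders S (e + 1)
      + ∑ i : Fin n, ∑ a : Fin 3, retailerOrders S (m + 1 + 3 * i + a)
      ≤ ∑ o ∈ S, o.2.card := by
  have h : retailerOrders S 0 + ∑ e : Fin m, retailerOrders S (e + 1)
      + ∑ i : Fin n, ∑ a : Fin 3, retailerOrders S (m + 1 + 3 * i + a)
      = ∑ ρ ∈ Finset.range (m + 1 + 3 * n), retailerOrders S ρ := by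
    rw [Finset.sum_range_add, sum_range_three_mul (fun k => retailerOrders S (m + 1 + k)),
      Finset.sum_range_succ', ← Fin.sum_univ_eq_sum_range (fun e => retailerOrders S (e + 1)),
      add_comm (retailerOrders S 0)]
    simp only [add_assoc]
  rw [h]
  simp only [retailerOrders, Finset.card_filter]
  rw [Finset.sum_comm]
  refine Finset.sum_le_sum fun o _ => ?_
  rw [← Finset.card_filter]
  exact Finset.card_le_card fun ρ hρ => (Finset.mem_filter.1 hρ).2

lemma sum_slot_indicator_le (m : ℕ) (t : ℝ) :
    (∑ e : Fin m, if 2 * (e : ℝ) ≤ t ∧ t ≤ 2 * (e : ℝ) + 1 then 1 else 0)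
      ≤ if 0 ≤ t ∧ t < 2 * m then 1 else 0 := by
  rw [← Finset.card_filter]
  split_ifs with h
  · rw [Finset.card_le_one]
    intro a ha b hb
    simp only [Finset.mem_filter, Finset.mem_univ, true_and] at ha hb
    have h₁ : (a : ℝ) < (b : ℝ) + 1 := by linarith
    have h₂ : (b : ℝ) < (a : ℝ) + 1 := by linarith
    norm_cast at h₁ h₂
    exact Fin.ext (by omega)
  · rw [Nat.le_zero, Finset.card_eq_zero, Finset.filter_eq_empty_iff]
    rintro e - ⟨h₁, h₂⟩
    have h₃ : ((e : ℕ) : ℝ) + 1 ≤ m := by exact_mod_cast e.2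
    have h₄ : (0 : ℝ) ≤ (e : ℕ) := Nat.cast_nonneg _
    exact h ⟨by linarith, by linarith⟩

lemma sum_betaPt_indicator_le (n m : ℕ) (t : ℝ) :
    (∑ i : Fin n, if t = betaPt m i then 1 else 0)
      ≤ if 8 * (m : ℝ) - n < t ∧ t ≤ 8 * m then 1 else 0 := by
  rw [← Finset.card_filter]
  split_ifs with h
  · rw [Finset.card_le_one]
    intro a ha b hb
    have h₀ : betaPt m a = betaPt m b :=
      (Finset.mem_filter.1 ha).2.symm.trans (Finset.mem_filter.1 hb).2
    have h₁ : (a : ℝ) = (b : ℝ) := sub_right_injective h₀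
    exact Fin.ext (by exact_mod_cast h₁)
  · rw [Nat.le_zero, Finset.card_eq_zero, Finset.filter_eq_empty_iff]
    rintro i - h₁
    have h₃ : ((i : ℕ) : ℝ) < n := by exact_mod_cast i.2
    have h₄ : (0 : ℝ) ≤ (i : ℕ) := Nat.cast_nonneg _
    unfold betaPt at h₁
    exact h ⟨by linarith, by linarith⟩

/-- Orders near edge slots, at the points `β_i`, and for the support retailer are distinct. -/
lemma slotOrders_add_orderAt_le_card {n m : ℕ} (hm : 2 * m = 3 * n) {S : Finset (ℝ × Finset ℕ)}
    (h₁ : SatJG S 0 (-(4 * (m : ℝ)) - 1) (-1)) (h₂ : SatJG S 0 (2 * (m : ℝ)) (6 * (m : ℝ)))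
    (h₃ : SatJG S 0 (8 * (m : ℝ) + 1) (12 * (m : ℝ) + 1)) :
    3 + ∑ e : Fin m, slotOrders S e + ∑ i : Fin n, orderAt S (betaPt m i) ≤ S.card := by
  have hm' : 2 * (m : ℝ) = 3 * n := by exact_mod_cast hm
  have hn0 : (0 : ℝ) ≤ n := Nat.cast_nonneg _
  have c₁ : 1 ≤ (S.filter (fun o => o.1 ≤ -1)).card := by
    obtain ⟨o, ho, -, -, h⟩ := h₁
    exact Finset.card_pos.2 ⟨o, Finset.mem_filter.2 ⟨ho, h⟩⟩
  have c₂ : 1 ≤ (S.filter (fun o => 2 * (m : ℝ) ≤ o.1 ∧ o.1 ≤ 6 * (m : ℝ))).card := by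
    obtain ⟨o, ho, -, h⟩ := h₂
    exact Finset.card_pos.2 ⟨o, Finset.mem_filter.2 ⟨ho, h⟩⟩
  have c₃ : 1 ≤ (S.filter (fun o => 8 * (m : ℝ) + 1 ≤ o.1)).card := by
    obtain ⟨o, ho, -, h, -⟩ := h₃
    exact Finset.card_pos.2 ⟨o, Finset.mem_filter.2 ⟨ho, h⟩⟩
  have c₄ : ∑ i : Fin n, orderAt S (betaPt m i)
      ≤ ∑ i : Fin n, (S.filter (fun o => o.1 = betaPt m i)).card :=
    Finset.sum_le_sum fun i _ => orderAt_le_card S _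
  suffices h : (S.filter (fun o => o.1 ≤ -1)).card
      + (S.filter (fun o => 2 * (m : ℝ) ≤ o.1 ∧ o.1 ≤ 6 * (m : ℝ))).card
      + (S.filter (fun o => 8 * (m : ℝ) + 1 ≤ o.1)).card + ∑ e : Fin m, slotOrders S e
      + ∑ i : Fin n, (S.filter (fun o => o.1 = betaPt m i)).card ≤ S.card by omega
  simp only [slotOrders, Finset.card_filter]
  rw [Finset.sum_comm, Finset.sum_comm (s := (Finset.univ : Finset (Fin n))),
    ← Finset.sum_add_distrib, ← Finset.sum_add_distrib, ← Finset.sum_add_distrib,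
    ← Finset.sum_add_distrib, Finset.card_eq_sum_ones]
  refine Finset.sum_le_sum fun o _ => ?_
  refine (add_le_add (add_le_add le_rfl (sum_slot_indicator_le m o.1))
    (sum_betaPt_indicator_le n m o.1)).trans ?_
  split_ifs <;> first | omega | (exfalso; grind)

/-- Counting incidences from the vertices is bounded by counting them from the edges. -/
lemma sum_incident_le {n m : ℕ} (E : Fin m → Fin n × Fin n) (j : Fin n → Fin 3 → Fin m)
    (hinc : ∀ i a, (E (j i a)).1 = i ∨ (E (j i a)).2 = i)
    (hjinj : ∀ i, Function.Injective (j i)) (f : Fin n → Fin m → ℕ) :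
    ∑ i, ∑ a, f i (j i a) ≤ ∑ e, (f (E e).1 e + f (E e).2 e) := by
  have h : ∀ i, ∑ a, f i (j i a) ≤
      ∑ e, ((if (E e).1 = i then f i e else 0) + (if (E e).2 = i then f i e else 0)) := by
    intro i
    rw [← Finset.sum_image (f := f i) (s := Finset.univ) (g := j i) ((hjinj i).injOn)]
    refine le_trans (Finset.sum_le_sum fun e he => ?_)
      (Finset.sum_le_sum_of_subset (Finset.subset_univ _))
    obtain ⟨a, -, rfl⟩ := Finset.mem_image.1 he
    rcases hinc i a with h | h
    · rw [if_pos h]; exact Nat.le_add_right _ _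
    · rw [if_pos h]; exact Nat.le_add_left _ _
  refine (Finset.sum_le_sum fun i _ => h i).trans ?_
  rw [Finset.sum_comm]
  simp [Finset.sum_add_distrib]

/-- A vertex set extends to a vertex cover by adding one vertex for each edge it misses. -/
lemma exists_vertexCover {n m : ℕ} (E : Fin m → Fin n × Fin n) (W : Finset (Fin n)) :
    ∃ U : Finset (Fin n), (∀ e, (E e).1 ∈ U ∨ (E e).2 ∈ U) ∧
      U.card + (Finset.univ.filter fun e => (E e).1 ∈ W ∨ (E e).2 ∈ W).card ≤ W.card + m := by
  classical
  refine ⟨W ∪ (Finset.univ.filter fun e => ¬ ((E e).1 ∈ W ∨ (E e).2 ∈ W)).image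
    (fun e => (E e).1), fun e => ?_, ?_⟩
  · by_cases h : (E e).1 ∈ W ∨ (E e).2 ∈ W
    · exact h.imp (Finset.mem_union_left _) (Finset.mem_union_left _)
    · exact Or.inl (Finset.mem_union_right _
        (Finset.mem_image.2 ⟨e, Finset.mem_filter.2 ⟨Finset.mem_univ _, h⟩, rfl⟩))
  · have h₁ := Finset.card_union_le W
      ((Finset.univ.filter fun e => ¬ ((E e).1 ∈ W ∨ (E e).2 ∈ W)).image (fun e => (E e).1))
    have h₂ := Finset.card_image_le (f := fun e => (E e).1)
      (s := Finset.univ.filter fun e => ¬ ((E e).1 ∈ W ∨ (E e).2 ∈ W))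
    have h₃ := Finset.card_filter_add_card_filter_not (s := (Finset.univ : Finset (Fin m)))
      (fun e => (E e).1 ∈ W ∨ (E e).2 ∈ W)
    rw [Finset.card_univ, Fintype.card_fin] at h₃
    omega

theorem schedule_to_vertex_cover
    (n m : ℕ) (hn : Even n) (hm : 2 * m = 3 * n)
    (E : Fin m → Fin n × Fin n) (hE : ∀ e, (E e).1 ≠ (E e).2)
    (j : Fin n → Fin 3 → Fin m)
    (hinc : ∀ i a, (E (j i a)).1 = i ∨ (E (j i a)).2 = i)
    (hjinj : ∀ i, Function.Injective (j i))
    (hcov : ∀ i e, ((E e).1 = i ∨ (E e).2 = i) → ∃ a, j i a = e)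
    (K : ℕ) (S : Finset (ℝ × Finset ℕ)) (hS : FeasibleJG E j S)
    (hcost : costJG S ≤ 10.5 * (n : ℝ) + (K : ℝ) + 6) :
    ∃ Uc : Finset (Fin n), (∀ e, (E e).1 ∈ Uc ∨ (E e).2 ∈ Uc) ∧ Uc.card ≤ K := by
  classical
  obtain ⟨⟨hs₁, hs₂, hs₃⟩, hedge, hvert⟩ := hS
  have hm' : 2 * (m : ℝ) = 3 * n := by exact_mod_cast hm
  set W : Finset (Fin n) := Finset.univ.filter fun i => orderAt S (betaPt m i) = 1 with hW
  have hWcard : ∑ i : Fin n, orderAt S (betaPt m i) = W.card := by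
    rw [hW, Finset.card_filter]
    refine Finset.sum_congr rfl fun i _ => ?_
    have := orderAt_le_one S (betaPt m i)
    split_ifs <;> omega
  let f : Fin n → Fin m → ℕ := fun i e => orderAt S (betaPt m i) * orderAt S (sidePt E i e)
  have hf : ∀ i e, f i e ≤ orderAt S (sidePt E i e) := fun i e =>
    (Nat.mul_le_mul_right _ (orderAt_le_one S _)).trans (one_mul _).le
  have hfW : ∀ i e, i ∉ W → f i e = 0 := by
    intro i e hi
    have h₁ := orderAt_le_one S (betaPt m i)
    have h₂ : orderAt S (betaPt m i) ≠ 1 := fun h =>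
      hi (Finset.mem_filter.2 ⟨Finset.mem_univ _, h⟩)
    have h₃ : orderAt S (betaPt m i) = 0 := by omega
    simp only [f, h₃, zero_mul]
  have hsupport : 3 ≤ retailerOrders S 0 := by
    obtain ⟨o₁, m₁, r₁, l₁, u₁⟩ := hs₁
    obtain ⟨o₂, m₂, r₂, l₂, u₂⟩ := hs₂
    obtain ⟨o₃, m₃, r₃, l₃, u₃⟩ := hs₃
    have hm0 : (0 : ℝ) ≤ m := Nat.cast_nonneg _
    exact three_le_retailerOrders m₁ m₂ m₃ r₁ r₂ r₃ (by linarith) (by linarith)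
  have hedges : ∑ e : Fin m, (2 + (f (E e).1 e + f (E e).2 e)) ≤
      ∑ e : Fin m, (retailerOrders S (e + 1) + slotOrders S e
        + if (E e).1 ∈ W ∨ (E e).2 ∈ W then 1 else 0) := by
    refine Finset.sum_le_sum fun e _ => ?_
    have h₁ := (hedge e).1.one_le
    have h₂ := two_le_retailerOrders_of_slotOrders_eq_zero (hedge e).1 (hedge e).2
    have h₃ := orderAt_add_le_slotOrders S (sidePt_endpoints (hE e)) (sidePt_mem E _ e)
      (sidePt_mem E _ e)
    have h₄ := hf (E e).1 e
    have h₅ := hf (E e).2 e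
    split_ifs with h
    · omega
    · have h₆ := hfW (E e).1 e fun hh => h (Or.inl hh)
      have h₇ := hfW (E e).2 e fun hh => h (Or.inr hh)
      omega
  have hverts : ∑ _i : Fin n, ∑ _a : Fin 3, 3 ≤
      ∑ i : Fin n, ∑ a : Fin 3, (retailerOrders S (m + 1 + 3 * i + a) + f i (j i a)) := by
    refine Finset.sum_le_sum fun i _ => Finset.sum_le_sum fun a _ => ?_
    obtain ⟨h₁, h₂, h₃, h₄⟩ := hvert i a
    refine three_le_retailerOrders_add ?_ h₁ h₂ h₃ h₄
    have h₅ := (sidePt_mem E i (j i a)).2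
    have h₆ : ((j i a : ℕ) : ℝ) + 1 ≤ m := by exact_mod_cast (j i a).2
    have h₇ : ((i : ℕ) : ℝ) + 1 ≤ n := by exact_mod_cast i.2
    rw [betaPt]
    linarith
  have hinc' := sum_incident_le E j hinc hjinj f
  have hret := sum_retailerOrders_le S n m
  have hware := slotOrders_add_orderAt_le_card hm hs₁ hs₂ hs₃
  have hcost' : 2 * (S.card + ∑ o ∈ S, o.2.card) ≤ 21 * n + 2 * K + 12 := by
    have h : costJG S = ((S.card + ∑ o ∈ S, o.2.card : ℕ) : ℝ) := by
      simp [costJG, Finset.sum_add_distrib]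
    rw [h] at hcost
    have : (2 : ℝ) * ((S.card + ∑ o ∈ S, o.2.card : ℕ) : ℝ) ≤ 21 * n + 2 * K + 12 := by
      linarith
    exact_mod_cast this
  obtain ⟨U, hU, hUcard⟩ := exists_vertexCover E W
  refine ⟨U, hU, ?_⟩
  rw [Finset.card_filter] at hUcard
  simp only [Finset.sum_add_distrib, Finset.sum_const, Finset.card_univ, Fintype.card_fin,
    smul_eq_mul] at hedges hverts hinc' hret
  omega
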